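/- arXiv:2303.07135 — 2 statements merged into one kernel-verified Lean document; each statement's English description precedes it below -/
import Mathlib

section
/- Let 0 < r < R. Define d_C(x,y,z) = √((√(x² + y²) − R)² + z²), the signed distance candidate ρ(x,y,z) = d_C(x,y,z) − r, and the torus 𝒯 = {p ∈ ℝ³ : ρ(p) = 0}. Then for every p ∈ ℝ³, the Euclidean distance from p to 𝒯 equals |ρ(p)|; i.e., ρ is the signed distance function of the torus with radii R and r. -/
/-- The Euclidean distance from `p = (x,y,z)` to the core circle
`C = {(a,b,0) : a² + b² = R²}`, namely `√((√(x² + y²) − R)² + z²)`. -/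
noncomputable def distToCircle (R : ℝ) (p : EuclideanSpace ℝ (Fin 3)) : ℝ :=
  Real.sqrt ((Real.sqrt ((p 0) ^ 2 + (p 1) ^ 2) - R) ^ 2 + (p 2) ^ 2)

/-- The signed distance candidate `ρ(x,y,z) = d_C(x,y,z) − r`. -/
noncomputable def torusSD (R r : ℝ) (p : EuclideanSpace ℝ (Fin 3)) : ℝ :=
  distToCircle R p - r

/-- Reverse triangle inequality for the Euclidean norm of the plane, in coordinates. -/
theorem sq_sqrt_sub_sqrt_le (a b c d : ℝ) :
    (Real.sqrt (a ^ 2 + b ^ 2) - Real.sqrt (c ^ 2 + d ^ 2)) ^ 2 ≤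
      (a - c) ^ 2 + (b - d) ^ 2 := by
  have h1 := Real.sq_sqrt (show 0 ≤ a ^ 2 + b ^ 2 by positivity)
  have h2 := Real.sq_sqrt (show 0 ≤ c ^ 2 + d ^ 2 by positivity)
  have h3 : a * c + b * d ≤ Real.sqrt (a ^ 2 + b ^ 2) * Real.sqrt (c ^ 2 + d ^ 2) := by
    rw [← Real.sqrt_mul (by positivity)]
    apply Real.le_sqrt_of_sq_le
    nlinarith [sq_nonneg (a * d - b * c)]
  nlinarith

/-- Polar coordinates in the plane, with an arbitrary direction at the origin. -/
theorem exists_unit_direction (a b : ℝ) :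
    ∃ c s : ℝ, c ^ 2 + s ^ 2 = 1 ∧
      a = Real.sqrt (a ^ 2 + b ^ 2) * c ∧ b = Real.sqrt (a ^ 2 + b ^ 2) * s := by
  have h := Real.sq_sqrt (show 0 ≤ a ^ 2 + b ^ 2 by positivity)
  by_cases h0 : Real.sqrt (a ^ 2 + b ^ 2) = 0
  · rw [h0] at h ⊢
    exact ⟨1, 0, by norm_num, by nlinarith [sq_nonneg a, sq_nonneg b],
      by nlinarith [sq_nonneg a, sq_nonneg b]⟩
  · refine ⟨a / Real.sqrt (a ^ 2 + b ^ 2), b / Real.sqrt (a ^ 2 + b ^ 2), ?_, ?_, ?_⟩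
    · rw [div_pow, div_pow, h, ← add_div, div_self]
      rw [← h]
      exact pow_ne_zero 2 h0
    · field_simp
    · field_simp

/-- The distance to the core circle is 1-Lipschitz. -/
theorem abs_distToCircle_sub_le_dist (R : ℝ) (p q : EuclideanSpace ℝ (Fin 3)) :
    |distToCircle R p - distToCircle R q| ≤ dist p q := by
  rw [EuclideanSpace.dist_eq, Fin.sum_univ_three]
  apply Real.abs_le_sqrt
  simp only [Real.dist_eq, sq_abs]
  have h1 := sq_sqrt_sub_sqrt_le (Real.sqrt (p 0 ^ 2 + p 1 ^ 2) - R) (p 2)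
    (Real.sqrt (q 0 ^ 2 + q 1 ^ 2) - R) (q 2)
  have h2 := sq_sqrt_sub_sqrt_le (p 0) (p 1) (q 0) (q 1)
  rw [sub_sub_sub_cancel_right] at h1
  unfold distToCircle
  linarith

/-- Every point has a point of the torus at distance `|ρ(p)|` from it. -/
theorem exists_torus_dist_eq (R r : ℝ) (hr : 0 < r) (hrR : r < R)
    (p : EuclideanSpace ℝ (Fin 3)) :
    ∃ q : EuclideanSpace ℝ (Fin 3), torusSD R r q = 0 ∧ dist p q = |torusSD R r p| := by
  obtain ⟨c, s, hcs, hc, hs⟩ := exists_unit_direction (p 0) (p 1)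
  obtain ⟨a, b, hab, ha, hb⟩ :=
    exists_unit_direction (Real.sqrt (p 0 ^ 2 + p 1 ^ 2) - R) (p 2)
  change _ = distToCircle R p * a at ha
  change _ = distToCircle R p * b at hb
  have hpos : 0 ≤ R + r * a := by
    have : -1 ≤ a := by nlinarith [sq_nonneg b]
    nlinarith
  refine ⟨!₂[(R + r * a) * c, (R + r * a) * s, r * b], ?_, ?_⟩
  · have h1 : ((R + r * a) * c) ^ 2 + ((R + r * a) * s) ^ 2 = (R + r * a) ^ 2 := by
      linear_combination (R + r * a) ^ 2 * hcs
    have h2 : (R + r * a - R) ^ 2 + (r * b) ^ 2 = r ^ 2 := by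
      linear_combination r ^ 2 * hab
    change Real.sqrt ((Real.sqrt (((R + r * a) * c) ^ 2 + ((R + r * a) * s) ^ 2) - R) ^ 2
      + (r * b) ^ 2) - r = 0
    rw [h1, Real.sqrt_sq hpos, h2, Real.sqrt_sq hr.le, sub_self]
  · rw [EuclideanSpace.dist_eq, Fin.sum_univ_three, ← Real.sqrt_sq_eq_abs]
    congr 1
    simp only [Real.dist_eq, sq_abs]
    change (p 0 - (R + r * a) * c) ^ 2 + (p 1 - (R + r * a) * s) ^ 2 + (p 2 - r * b) ^ 2
      = (distToCircle R p - r) ^ 2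
    generalize Real.sqrt (p 0 ^ 2 + p 1 ^ 2) = t at *
    generalize distToCircle R p = d at *
    obtain rfl : t = R + d * a := by linarith
    rw [hc, hs, hb]
    linear_combination (d * a - r * a) ^ 2 * hcs + (d - r) ^ 2 * hab

/-- For `0 < r < R` and the torus `𝒯 = {p : ρ(p) = 0}`, the Euclidean
distance from any `p ∈ ℝ³` to `𝒯` equals `|ρ(p)|`, i.e. `ρ` is the signed distance
function of the torus with radii `R` and `r`. -/
theorem infDist_torus_eq_abs_signedDist (R r : ℝ) (hr : 0 < r) (hrR : r < R)
    (p : EuclideanSpace ℝ (Fin 3)) :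
    Metric.infDist p {q : EuclideanSpace ℝ (Fin 3) | torusSD R r q = 0} =
      |torusSD R r p| := by
  obtain ⟨q, hq, hpq⟩ := exists_torus_dist_eq R r hr hrR p
  apply le_antisymm
  · rw [← hpq]
    exact Metric.infDist_le_dist_of_mem hq
  · refine (Metric.le_infDist ⟨q, hq⟩).2 fun x hx => ?_
    have hxr : distToCircle R x = r := sub_eq_zero.1 hx
    simpa only [torusSD, hxr] using abs_distToCircle_sub_le_dist R p x
end

section
/- For every ε > 0, the surface delta approximation is exactly normalized along the normal direction: ∫_ℝ W(φ_ε(t)) dt = 1, where W(φ) = (36/ε)·(1 − φ)²·φ² and φ_ε(t) = ½(1 − tanh(3t/ε)). -/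
/-- The one-dimensional phase-field profile `φ_ε(t) = ½(1 − tanh(3t/ε))` with
interface width `ε > 0`. -/
noncomputable def phaseProfile (ε t : ℝ) : ℝ :=
  (1 / 2) * (1 - Real.tanh (3 * t / ε))

/-- The scaled double-well density `W(φ) = (36/ε)·(1 − φ)²·φ²`. -/
noncomputable def doubleWell (ε φ : ℝ) : ℝ :=
  (36 / ε) * (1 - φ) ^ 2 * φ ^ 2

open Filter Topology MeasureTheory Set

theorem Real.hasDerivAt_tanh (x : ℝ) :
    HasDerivAt Real.tanh (1 - Real.tanh x ^ 2) x := by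
  have hc : Real.cosh x ≠ 0 := (Real.cosh_pos x).ne'
  have h := (Real.hasDerivAt_sinh x).div (Real.hasDerivAt_cosh x) hc
  have hf : Real.tanh = Real.sinh / Real.cosh := by
    ext y
    simp [Real.tanh_eq_sinh_div_cosh]
  rw [hf]
  refine h.congr_deriv ?_
  rw [← hf, Real.tanh_eq_sinh_div_cosh]
  field_simp

theorem Real.tendsto_tanh_atTop : Tendsto Real.tanh atTop (𝓝 1) := by
  have hf : Real.tanh = fun x => 1 - 2 / (Real.exp (2 * x) + 1) := by
    ext x
    have h : Real.exp (2 * x) = Real.exp x * Real.exp x := by rw [← Real.exp_add]; ring_nf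
    have := Real.exp_pos x
    rw [Real.tanh_eq, Real.exp_neg, h]
    field_simp
    ring
  have h : Tendsto (fun x : ℝ => Real.exp (2 * x) + 1) atTop atTop :=
    tendsto_atTop_add_const_right _ _
      (Real.tendsto_exp_atTop.comp (tendsto_id.const_mul_atTop two_pos))
  simpa [hf] using (h.const_div_atTop 2).const_sub 1

theorem Real.tendsto_tanh_atBot : Tendsto Real.tanh atBot (𝓝 (-1)) := by
  simpa [Function.comp_def] using (Real.tendsto_tanh_atTop.comp tendsto_neg_atBot_atTop).neg

/-- The improper fundamental theorem of calculus on `ℝ` for a nonnegative derivative. -/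
theorem integral_of_hasDerivAt_of_nonneg {g g' : ℝ → ℝ} {m n : ℝ}
    (hderiv : ∀ x, HasDerivAt g (g' x) x) (g'pos : ∀ x, 0 ≤ g' x)
    (hbot : Tendsto g atBot (𝓝 m)) (htop : Tendsto g atTop (𝓝 n)) :
    ∫ x, g' x = n - m := by
  refine integral_of_hasDerivAt_of_tendsto hderiv ?_ hbot htop
  rw [← integrableOn_univ, ← Iic_union_Ioi (a := (0 : ℝ))]
  refine IntegrableOn.union ?_ ?_
  · have hr : IntegrableOn (fun x => g' (-x)) (Ioi 0) := by
      refine integrableOn_Ioi_deriv_of_nonneg' (g := fun x => -g (-x)) (l := -m)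
        (fun x _ => ?_) (fun x _ => g'pos _) (hbot.comp tendsto_neg_atTop_atBot).neg
      simpa [Function.comp_def] using ((hderiv (-x)).comp x (hasDerivAt_neg x)).fun_neg
    rw [integrableOn_Iic_iff_integrableOn_Iio]
    simpa using hr.comp_neg
  · exact integrableOn_Ioi_deriv_of_nonneg' (fun x _ => hderiv x) (fun x _ => g'pos x) htop

/-- For every `ε > 0`, the surface delta approximation is exactly
normalized along the normal direction: `∫_ℝ W(φ_ε(t)) dt = 1`. -/
theorem doubleWell_normalized (ε : ℝ) (hε : 0 < ε) :
    ∫ t : ℝ, doubleWell ε (phaseProfile ε t) = 1 := by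
  set T : ℝ → ℝ := fun t => Real.tanh (3 * t / ε) with hT
  have hlin (t : ℝ) : HasDerivAt (fun t : ℝ => 3 * t / ε) (3 / ε) t := by
    simpa using ((hasDerivAt_id t).const_mul 3).div_const ε
  have hTd (t : ℝ) : HasDerivAt T ((1 - T t ^ 2) * (3 / ε)) t :=
    HasDerivAt.comp (h₂ := Real.tanh) t (Real.hasDerivAt_tanh (3 * t / ε)) (hlin t)
  have hderiv (t : ℝ) : HasDerivAt (fun t => 3 / 4 * T t - 1 / 4 * T t ^ 3)
      (doubleWell ε (phaseProfile ε t)) t := by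
    refine (((hTd t).const_mul (3 / 4)).fun_sub
      (((hTd t).fun_pow 3).const_mul (1 / 4))).congr_deriv ?_
    simp only [doubleWell, phaseProfile, hT]
    field_simp
    ring
  have hnonneg (t : ℝ) : 0 ≤ doubleWell ε (phaseProfile ε t) := by
    unfold doubleWell
    positivity
  have htop : Tendsto T atTop (𝓝 1) := Real.tendsto_tanh_atTop.comp
    ((tendsto_id.const_mul_atTop three_pos).atTop_div_const hε)
  have hbot : Tendsto T atBot (𝓝 (-1)) := Real.tendsto_tanh_atBot.comp
    ((tendsto_id.const_mul_atBot three_pos).atBot_div_const hε)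
  rw [integral_of_hasDerivAt_of_nonneg hderiv hnonneg
    ((hbot.const_mul _).sub ((hbot.pow 3).const_mul _))
    ((htop.const_mul _).sub ((htop.pow 3).const_mul _))]
  norm_num
end
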